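/- Let (Γ; ≤₁, …, ≤ₙ) be a homogeneous n-dimensional permutation structure with n ≥ 2, and let Λ be its lattice of ∅-definable equivalence relations. Then any meet-irreducible E ∈ Λ (i.e., E is not the trivial relation, and whenever E = F ⊓ G with F, G ∈ Λ, then E = F or E = G) is convex with respect to at least two of the orders in the language: there exist distinct i, j ≤ n such that E is ≤ᵢ-convex and ≤ⱼ-convex. -/

import Mathlib

/-- An `n`-dimensional permutation structure: a set `Γ` equipped with `n` linear orders. -/
structure PermStruct (n : ℕ) (Γ : Type*) where
  le : Fin n → Γ → Γ → Prop
  total : ∀ i x y, le i x y ∨ le i y x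
  antisymm : ∀ i x y, le i x y → le i y x → x = y
  trans : ∀ i x y z, le i x y → le i y z → le i x z

namespace PermStruct

variable {n : ℕ} {Γ : Type*} (S : PermStruct n Γ)

/-- An automorphism of the permutation structure: a bijection of `Γ` preserving each order. -/
def IsAuto (σ : Γ ≃ Γ) : Prop :=
  ∀ i x y, S.le i x y ↔ S.le i (σ x) (σ y)

/-- Homogeneity: every isomorphism between finite substructures (i.e. every bijection between
finite subsets preserving each order) extends to an automorphism. -/
def Homogeneous : Prop :=
  ∀ (A : Finset Γ) (f : Γ → Γ), Set.InjOn f A →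
    (∀ i, ∀ x ∈ A, ∀ y ∈ A, (S.le i x y ↔ S.le i (f x) (f y))) →
    ∃ σ : Γ ≃ Γ, S.IsAuto σ ∧ ∀ a ∈ A, σ a = f a

/-- A binary relation is ∅-definable iff it is invariant under all automorphisms. -/
def Definable (R : Γ → Γ → Prop) : Prop :=
  ∀ σ : Γ ≃ Γ, S.IsAuto σ → ∀ x y, R x y ↔ R (σ x) (σ y)

/-- `E` is `≤ᵢ`-convex: every `E`-class is an interval with respect to `≤ᵢ`. -/
def Convex (i : Fin n) (E : Γ → Γ → Prop) : Prop :=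
  ∀ x y z, S.le i x y → S.le i y z → E x z → E x y

end PermStruct

namespace PermStruct

section Basic

variable {n : ℕ} {Γ : Type*} (S : PermStruct n Γ)

/-- The strict version of the `j`-th order, reversed when the sign `ε` is `false`. -/
def SLt (j : Fin n) (ε : Bool) (x y : Γ) : Prop :=
  x ≠ y ∧ if ε then S.le j x y else S.le j y x

/-- The pair `(x, y)` realizes the 2-type with sign vector `u`. -/
def HasType (u : Fin n → Bool) (x y : Γ) : Prop :=
  ∀ j, S.SLt j (u j) x y

variable {S}

theorem SLt.ne {j : Fin n} {ε : Bool} {x y : Γ} (h : S.SLt j ε x y) : x ≠ y := h.1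

theorem SLt.trans {j : Fin n} {ε : Bool} {x y z : Γ} (h : S.SLt j ε x y) (h' : S.SLt j ε y z) :
    S.SLt j ε x z := by
  obtain ⟨hxy, h⟩ := h
  obtain ⟨hyz, h'⟩ := h'
  cases ε
  · simp only [Bool.false_eq_true, if_false] at h h'
    refine ⟨?_, by simpa using S.trans _ _ _ _ h' h⟩
    rintro rfl
    exact hxy (S.antisymm _ _ _ h' h)
  · simp only [if_true] at h h'
    refine ⟨?_, by simpa using S.trans _ _ _ _ h h'⟩
    rintro rfl
    exact hxy (S.antisymm _ _ _ h h')

theorem SLt.asymm {j : Fin n} {ε : Bool} {x y : Γ} (h : S.SLt j ε x y) : ¬ S.SLt j ε y x :=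
  fun h' => (h.trans h').ne rfl

theorem sLt_or_sLt (j : Fin n) (ε : Bool) {x y : Γ} (h : x ≠ y) :
    S.SLt j ε x y ∨ S.SLt j ε y x := by
  have := S.total j x y
  cases ε <;> simp [SLt, h, h.symm] <;> tauto

theorem eq_or_sLt_of_not_sLt {j : Fin n} {ε : Bool} {x y : Γ} (h : ¬ S.SLt j ε x y) :
    x = y ∨ S.SLt j ε y x := by
  by_cases hxy : x = y
  · exact Or.inl hxy
  · exact Or.inr ((sLt_or_sLt j ε hxy).resolve_left h)

theorem SLt.trans_not {j : Fin n} {ε : Bool} {x y z : Γ} (h : S.SLt j ε x y)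
    (h' : ¬ S.SLt j ε z y) : S.SLt j ε x z := by
  rcases eq_or_sLt_of_not_sLt h' with rfl | h'
  · exact h
  · exact h.trans h'

theorem sLt_not {j : Fin n} {ε : Bool} {x y : Γ} : S.SLt j (!ε) x y ↔ S.SLt j ε y x := by
  cases ε <;> simp [SLt, ne_comm]

theorem IsAuto.sLt_iff {σ : Γ ≃ Γ} (hσ : S.IsAuto σ) {j : Fin n} {ε : Bool} {x y : Γ} :
    S.SLt j ε (σ x) (σ y) ↔ S.SLt j ε x y := by
  simp only [SLt, ne_eq, EmbeddingLike.apply_eq_iff_eq, ← hσ j]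

theorem HasType.ne [NeZero n] {u : Fin n → Bool} {x y : Γ} (h : S.HasType u x y) : x ≠ y :=
  (h 0).ne

theorem HasType.trans {u : Fin n → Bool} {x y z : Γ} (h : S.HasType u x y)
    (h' : S.HasType u y z) : S.HasType u x z :=
  fun j => (h j).trans (h' j)

theorem exists_hasType {x y : Γ} (h : x ≠ y) : ∃ u, S.HasType u x y := by
  classical
  refine ⟨fun j => decide (S.SLt j true x y), fun j => ?_⟩
  by_cases hj : S.SLt j true x y
  · simp [hj]
  · simpa [hj] using sLt_not.2 ((sLt_or_sLt j true h).resolve_left hj)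

theorem IsAuto.hasType_iff {σ : Γ ≃ Γ} (hσ : S.IsAuto σ) {u : Fin n → Bool} {x y : Γ} :
    S.HasType u (σ x) (σ y) ↔ S.HasType u x y :=
  forall_congr' fun _ => hσ.sLt_iff

theorem HasType.le_iff {u : Fin n → Bool} {x y x' y' : Γ} (h : S.HasType u x y)
    (h' : S.HasType u x' y') (j : Fin n) :
    (S.le j x y ↔ S.le j x' y') ∧ (S.le j y x ↔ S.le j y' x') := by
  have key : ∀ {a b : Γ}, S.HasType u a b →
      (S.le j a b ↔ u j = true) ∧ (S.le j b a ↔ u j = false) := by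
    intro a b hab
    obtain ⟨hne, hle⟩ := hab j
    cases hu : u j
    · simp only [hu, Bool.false_eq_true, if_false] at hle
      exact ⟨by simpa using fun h' => hne (S.antisymm _ _ _ h' hle), by simpa using hle⟩
    · simp only [hu, if_true] at hle
      exact ⟨by simpa using hle, by simpa using fun h' => hne (S.antisymm _ _ _ hle h')⟩
  rw [(key h).1, (key h).2, (key h').1, (key h').2]
  exact ⟨Iff.rfl, Iff.rfl⟩

theorem Homogeneous.exists_auto_of_family (hhom : S.Homogeneous) {ι : Type*} [Fintype ι]
    {f g : ι → Γ} (hf : Function.Injective f) (hg : Function.Injective g)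
    (h : ∀ i a b, S.le i (f a) (f b) ↔ S.le i (g a) (g b)) :
    ∃ σ : Γ ≃ Γ, S.IsAuto σ ∧ ∀ a, σ (f a) = g a := by
  classical
  have hinv : ∀ a, Function.extend f g id (f a) = g a := fun a => hf.extend_apply g id a
  obtain ⟨σ, hσ, hσ'⟩ := hhom (Finset.univ.image f) (Function.extend f g id)
    (by
      intro x hx y hy hxy
      simp only [Finset.coe_image, Finset.coe_univ, Set.image_univ, Set.mem_range] at hx hy
      obtain ⟨a, rfl⟩ := hx
      obtain ⟨b, rfl⟩ := hy
      rw [hinv, hinv] at hxy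
      rw [hg hxy])
    (by
      intro i x hx y hy
      simp only [Finset.mem_image, Finset.mem_univ, true_and] at hx hy
      obtain ⟨a, rfl⟩ := hx
      obtain ⟨b, rfl⟩ := hy
      rw [hinv, hinv, h])
  exact ⟨σ, hσ, fun a => by rw [hσ' _ (by simp), hinv]⟩

theorem Homogeneous.exists_auto_map (hhom : S.Homogeneous) (x y : Γ) :
    ∃ σ : Γ ≃ Γ, S.IsAuto σ ∧ σ x = y := by
  have hrefl : ∀ i z, S.le i z z := fun i z => (S.total i z z).elim id id
  obtain ⟨σ, hσ, h⟩ := hhom.exists_auto_of_family (ι := Unit) (f := fun _ => x) (g := fun _ => y)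
    (Function.injective_of_subsingleton _) (Function.injective_of_subsingleton _)
    (fun i _ _ => by simp [hrefl])
  exact ⟨σ, hσ, h ()⟩

theorem Homogeneous.exists_auto_of_pairwise [NeZero n] (hhom : S.Homogeneous) {k : ℕ}
    {f g : Fin k → Γ}
    (h : ∀ a b, a < b → ∃ u, S.HasType u (f a) (f b) ∧ S.HasType u (g a) (g b)) :
    ∃ σ : Γ ≃ Γ, S.IsAuto σ ∧ ∀ a, σ (f a) = g a := by
  have hrefl : ∀ i z, S.le i z z := fun i z => (S.total i z z).elim id id
  refine hhom.exists_auto_of_family ?_ ?_ ?_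
  · refine Function.Injective.of_lt_imp_ne fun a b hab => ?_
    obtain ⟨u, hu, -⟩ := h a b hab
    exact hu.ne
  · refine Function.Injective.of_lt_imp_ne fun a b hab => ?_
    obtain ⟨u, -, hu⟩ := h a b hab
    exact hu.ne
  · intro i a b
    rcases lt_trichotomy a b with hab | rfl | hab
    · obtain ⟨u, hu, hu'⟩ := h a b hab
      exact (hu.le_iff hu' i).1
    · simp [hrefl]
    · obtain ⟨u, hu, hu'⟩ := h b a hab
      exact (hu.le_iff hu' i).2

theorem Homogeneous.exists_auto_of_hasType [NeZero n] (hhom : S.Homogeneous)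
    {u : Fin n → Bool} {x y x' y' : Γ} (h : S.HasType u x y) (h' : S.HasType u x' y') :
    ∃ σ : Γ ≃ Γ, S.IsAuto σ ∧ σ x = x' ∧ σ y = y' := by
  obtain ⟨σ, hσ, hfg⟩ := hhom.exists_auto_of_pairwise (f := ![x, y]) (g := ![x', y'])
    (by
      intro a b hab
      refine ⟨u, ?_⟩
      fin_cases a <;> fin_cases b <;> simp_all)
  exact ⟨σ, hσ, hfg 0, hfg 1⟩

end Basic

section Ramsey

variable {V K : Type*}

/-- `MonoTree N c F k X` says that `X` is the set of leaves of a full binary tree of depth `k` in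
which the two halves below every node are separated by `N`-cones, and `c` takes values in `F` on
all pairs consisting of a leaf of a left half and a leaf of the corresponding right half. -/
inductive MonoTree (N : V → V → Prop) (c : V → V → K) (F : Finset K) : ℕ → Finset V → Prop
  | leaf (x : V) : MonoTree N c F 0 {x}
  | node {k : ℕ} {X Y Z : Finset V} (v w : V) (hX : MonoTree N c F k X)
      (hY : MonoTree N c F k Y) (hZ : ∀ z, z ∈ Z ↔ z ∈ X ∨ z ∈ Y)
      (hXv : ∀ x ∈ X, N x v) (hYv : ∀ y ∈ Y, ¬ N y v) (hYw : ∀ y ∈ Y, N y w)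
      (hXw : ∀ x ∈ X, ¬ N x w) (hc : ∀ x ∈ X, ∀ y ∈ Y, c x y ∈ F) :
      MonoTree N c F (k + 1) Z

namespace MonoTree

variable {N : V → V → Prop} {c : V → V → K} {F : Finset K}

theorem nonempty {k : ℕ} {X : Finset V} (h : MonoTree N c F k X) : X.Nonempty := by
  induction h with
  | leaf x => simp
  | node v w _ _ hZ _ _ _ _ _ ihX _ =>
    obtain ⟨x, hx⟩ := ihX
    exact ⟨x, (hZ x).2 (Or.inl hx)⟩

theorem card_le {k : ℕ} {X : Finset V} (h : MonoTree N c F k X) : X.card ≤ 2 ^ k := by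
  classical
  induction h with
  | leaf x => simp
  | @node k X Y Z _ _ _ _ hZ _ _ _ _ _ ihX ihY =>
    obtain rfl : Z = X ∪ Y := by ext z; simp [hZ]
    have := Finset.card_union_le X Y
    omega

theorem split {X : Finset V} (p : V → Prop) :
    ∀ {k l m : ℕ}, m = k + l → MonoTree N c F m X →
    (∃ Y ⊆ X, MonoTree N c F k Y ∧ ∀ y ∈ Y, p y) ∨
      ∃ Y ⊆ X, MonoTree N c F l Y ∧ ∀ y ∈ Y, ¬ p y := by
  intro k l m hm h
  induction h generalizing k l with
  | leaf x =>
    obtain ⟨rfl, rfl⟩ : k = 0 ∧ l = 0 := by omega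
    by_cases hx : p x
    · exact Or.inl ⟨{x}, subset_rfl, .leaf x, by simpa using hx⟩
    · exact Or.inr ⟨{x}, subset_rfl, .leaf x, by simpa using hx⟩
  | @node m X₀ X₁ Z v w h₀ h₁ hZ hXv hYv hYw hXw hc ih₀ ih₁ =>
    classical
    have s₀ : X₀ ⊆ Z := fun x hx => (hZ x).2 (Or.inl hx)
    have s₁ : X₁ ⊆ Z := fun x hx => (hZ x).2 (Or.inr hx)
    have join : ∀ {d : ℕ} {Y₀ Y₁ : Finset V}, Y₀ ⊆ X₀ → Y₁ ⊆ X₁ → MonoTree N c F d Y₀ →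
        MonoTree N c F d Y₁ → MonoTree N c F (d + 1) (Y₀ ∪ Y₁) := fun i₀ i₁ t₀ t₁ =>
      .node v w t₀ t₁ (fun z => by simp) (fun x hx => hXv x (i₀ hx)) (fun y hy => hYv y (i₁ hy))
        (fun y hy => hYw y (i₁ hy)) (fun x hx => hXw x (i₀ hx))
        (fun x hx y hy => hc x (i₀ hx) y (i₁ hy))
    rcases k with _ | k
    · by_cases hp : ∃ z ∈ Z, p z
      · obtain ⟨z, hz, hpz⟩ := hp
        exact Or.inl ⟨{z}, by simpa using hz, .leaf z, by simpa using hpz⟩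
      · push Not at hp
        obtain rfl : l = m + 1 := by omega
        exact Or.inr ⟨Z, subset_rfl, .node v w h₀ h₁ hZ hXv hYv hYw hXw hc, hp⟩
    · rcases ih₀ (k := k) (l := l) (by omega) with ⟨Y₀, i₀, t₀, hp₀⟩ | ⟨Y₀, i₀, t₀, hp₀⟩
      · rcases ih₁ (k := k) (l := l) (by omega) with ⟨Y₁, i₁, t₁, hp₁⟩ | ⟨Y₁, i₁, t₁, hp₁⟩
        · refine Or.inl ⟨Y₀ ∪ Y₁, Finset.union_subset (i₀.trans s₀) (i₁.trans s₁),
            join i₀ i₁ t₀ t₁, fun y hy => ?_⟩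
          rcases Finset.mem_union.1 hy with hy | hy
          exacts [hp₀ y hy, hp₁ y hy]
        · exact Or.inr ⟨Y₁, i₁.trans s₁, t₁, hp₁⟩
      · exact Or.inr ⟨Y₀, i₀.trans s₀, t₀, hp₀⟩

theorem exists_subset {k m : ℕ} {X : Finset V} (h : MonoTree N c F m X) (hk : k ≤ m) :
    ∃ Y ⊆ X, MonoTree N c F k Y := by
  rcases h.split (fun _ => True) (k := k) (l := m - k) (by omega) with
    ⟨Y, hY, hT, -⟩ | ⟨Y, -, hT, hp⟩
  · exact ⟨Y, hY, hT⟩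
  · obtain ⟨y, hy⟩ := hT.nonempty
    exact absurd trivial (hp y hy)

/-- Pigeonhole: a colouring of the leaves of a deep tree is constant on a subtree. -/
theorem exists_const {k : ℕ} (g : V → K) (G : Finset K) {X : Finset V}
    (h : MonoTree N c F (G.card * k) X) (hg : ∀ x ∈ X, g x ∈ G) :
    ∃ t ∈ G, ∃ Y ⊆ X, MonoTree N c F k Y ∧ ∀ y ∈ Y, g y = t := by
  classical
  induction G using Finset.induction_on generalizing X with
  | empty =>
    obtain ⟨x, hx⟩ := h.nonempty
    exact absurd (hg x hx) (by simp)
  | insert t G ht ih =>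
    rw [Finset.card_insert_of_notMem ht] at h
    rcases h.split (fun x => g x = t) (k := k) (l := G.card * k) (by ring) with
      ⟨Y, hY, hT, hp⟩ | ⟨Y, hY, hT, hp⟩
    · exact ⟨t, by simp, Y, hY, hT, hp⟩
    · obtain ⟨s, hs, Y', hY', hT', hp'⟩ := ih hT fun y hy =>
        (Finset.mem_insert.1 (hg y (hY hy))).resolve_left (hp y hy)
      exact ⟨s, Finset.mem_insert_of_mem hs, Y', hY'.trans hY, hT', hp'⟩

/-- A deep tree is not covered by few sets none of which contains a tree of depth `q`. -/
theorem exists_forall {q : ℕ} {W : Type*} (A : Finset W) (p : W → V → Prop) {X : Finset V}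
    (h : MonoTree N c F (A.card * q) X)
    (hp : ∀ a ∈ A, ∀ Y ⊆ X, MonoTree N c F q Y → ∃ y ∈ Y, p a y) :
    ∃ x ∈ X, ∀ a ∈ A, p a x := by
  classical
  induction A using Finset.induction_on generalizing X with
  | empty =>
    obtain ⟨x, hx⟩ := h.nonempty
    exact ⟨x, hx, by simp⟩
  | insert a A ha ih =>
    rw [Finset.card_insert_of_notMem ha] at h
    rcases h.split (fun x => p a x) (k := A.card * q) (l := q) (by ring) with
      ⟨Y, hY, hT, hpY⟩ | ⟨Y, hY, hT, hpY⟩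
    · obtain ⟨x, hx, hxA⟩ := ih hT fun b hb Z hZ =>
        hp b (Finset.mem_insert_of_mem hb) Z (hZ.trans hY)
      refine ⟨x, hY hx, fun b hb => ?_⟩
      rcases Finset.mem_insert.1 hb with rfl | hb
      exacts [hpY x hx, hxA b hb]
    · obtain ⟨y, hy, hpy⟩ := hp a (by simp) Y hY hT
      exact absurd hpy (hpY y hy)

theorem erase [DecidableEq K] {k : ℕ} {X : Finset V} {t : K} (h : MonoTree N c F k X)
    (ht : ∀ x ∈ X, ∀ y ∈ X, c x y ≠ t) : MonoTree N c (F.erase t) k X := by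
  induction h with
  | leaf x => exact .leaf x
  | node v w _ _ hZ hXv hYv hYw hXw hc ihX ihY =>
    have i₀ := fun x hx => (hZ x).2 (Or.inl hx)
    have i₁ := fun x hx => (hZ x).2 (Or.inr hx)
    exact .node v w (ihX fun x hx y hy => ht x (i₀ x hx) y (i₀ y hy))
      (ihY fun x hx y hy => ht x (i₁ x hx) y (i₁ y hy)) hZ hXv hYv hYw hXw
      fun x hx y hy => Finset.mem_erase.2 ⟨ht x (i₀ x hx) y (i₁ y hy), hc x hx y hy⟩

theorem exists_of_branching [Fintype K] (htrans : ∀ x y z, N x y → N y z → N x z)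
    (hbr : ∀ w, ∃ u v, N u w ∧ N v w ∧ ∀ x, N x u → ¬ N x v) (k : ℕ) (w : V) :
    ∃ X, MonoTree N c Finset.univ k X ∧ ∀ x ∈ X, N x w := by
  classical
  induction k generalizing w with
  | zero =>
    obtain ⟨u, -, hu, -⟩ := hbr w
    exact ⟨{u}, .leaf u, by simpa using hu⟩
  | succ k ih =>
    obtain ⟨u, v, hu, hv, huv⟩ := hbr w
    obtain ⟨X, hX, hXu⟩ := ih u
    obtain ⟨Y, hY, hYv⟩ := ih v
    refine ⟨X ∪ Y, .node u v hX hY (fun z => by simp) hXu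
      (fun y hy h => huv y h (hYv y hy)) hYv (fun x hx => huv x (hXu x hx))
      (fun _ _ _ _ => Finset.mem_univ _), fun z hz => ?_⟩
    rcases Finset.mem_union.1 hz with hz | hz
    exacts [htrans _ _ _ (hXu z hz) hu, htrans _ _ _ (hYv z hz) hv]

end MonoTree

/-- In a branching tree order with finitely many colours on pairs there are two monochromatic
triples of the same colour, one of which branches first on the right and the other on the left. -/
theorem exists_mono_triples [Finite K] [Nonempty V] {N : V → V → Prop} (c : V → V → K)
    (htrans : ∀ x y z, N x y → N y z → N x z)
    (hbr : ∀ w, ∃ u v, N u w ∧ N v w ∧ ∀ x, N x u → ¬ N x v) :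
    ∃ t, (∃ x y z w, c x y = t ∧ c x z = t ∧ c y z = t ∧ N x w ∧ N y w ∧ ¬ N z w) ∧
      ∃ x y z w, c x y = t ∧ c x z = t ∧ c y z = t ∧ N y w ∧ N z w ∧ ¬ N x w := by
  classical
  have := Fintype.ofFinite K
  obtain ⟨F, hF, hmin⟩ : ∃ F : Finset K, (∀ k, ∃ X, MonoTree N c F k X) ∧
      ∀ t ∈ F, ¬ ∀ k, ∃ X, MonoTree N c (F.erase t) k X := by
    have hex : ∃ F : Finset K, ∀ k, ∃ X, MonoTree N c F k X :=
      ⟨Finset.univ, fun k => (MonoTree.exists_of_branching htrans hbr k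
        (Classical.arbitrary V)).imp fun _ h => h.1⟩
    obtain ⟨F, hF⟩ := exists_minimal_of_wellFoundedLT _ hex
    exact ⟨F, hF.prop, fun t ht h => Finset.notMem_erase t F (hF.le_of_le h (F.erase_subset t) ht)⟩
  obtain ⟨k, hk⟩ : ∃ k, ∀ X, MonoTree N c F k X → ∀ t ∈ F, ∃ x ∈ X, ∃ y ∈ X, c x y = t := by
    push Not at hmin
    choose! d hd using hmin
    refine ⟨F.sup d, fun X hX t ht => ?_⟩
    by_contra! hne
    obtain ⟨Y, -, hY⟩ := (hX.erase hne).exists_subset (Finset.le_sup (f := d) ht)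
    exact hd t ht Y hY
  by_contra! hLR
  obtain ⟨X, hX⟩ := hF (2 ^ (F.card * k) * (F.card * k) + F.card * k + 1)
  obtain _ | @⟨_, X₀, X₁, _, v, w, h₀, h₁, -, hXv, hYv, hYw, hXw, hc⟩ := hX
  obtain ⟨Y₀, hY₀, hT₀⟩ := h₀.exists_subset (k := F.card * k) (by omega)
  obtain ⟨Y₁, hY₁, hT₁⟩ := h₁.exists_subset (k := Y₀.card * (F.card * k)) (by
    have := Nat.mul_le_mul_right (F.card * k) hT₀.card_le
    omega)
  obtain ⟨y, hy, hyR⟩ := hT₁.exists_forall Y₀ (fun x y => ∃ x' y' z' w, c x' y' = c x y ∧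
      c x' z' = c x y ∧ c y' z' = c x y ∧ N y' w ∧ N z' w ∧ ¬ N x' w) (by
    intro x hx Z hZ hTZ
    have hZ₁ := hZ.trans hY₁
    obtain ⟨t, ht, Z', hZ', hTZ', hct⟩ :=
      hTZ.exists_const (c x) F fun z hz => hc x (hY₀ hx) z (hZ₁ hz)
    obtain ⟨y, hy, z, hz, hyz⟩ := hk Z' hTZ' t ht
    exact ⟨y, hZ' hy, x, y, z, w, rfl, by rw [hct y hy, hct z hz], by rw [hyz, hct y hy],
      hYw y (hZ₁ (hZ' hy)), hYw z (hZ₁ (hZ' hz)), hXw x (hY₀ hx)⟩)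
  obtain ⟨t, ht, Z, hZ, hTZ, hct⟩ :=
    hT₀.exists_const (fun x => c x y) F fun x hx => hc x (hY₀ hx) y (hY₁ hy)
  obtain ⟨x, hx, x', hx', hxx'⟩ := hk Z hTZ t ht
  obtain ⟨x₁, y₁, z₁, w₁, h12, h13, h23, hy₁, hz₁, hx₁⟩ := hyR x (hZ hx)
  rw [hct x hx] at h12 h13 h23
  exact hx₁ (hLR t ⟨x, x', y, v, hxx', hct x hx, hct x' hx', hXv x (hY₀ (hZ hx)),
    hXv x' (hY₀ (hZ hx')), hYv y (hY₁ hy)⟩ x₁ y₁ z₁ w₁ h12 h13 h23 hy₁ hz₁)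

end Ramsey

section Pushing

variable {n : ℕ} {Γ : Type*} {S : PermStruct n Γ} {E : Γ → Γ → Prop}

variable (S E) in
/-- `E` is a ∅-definable equivalence relation on the homogeneous structure `S`, and `E` is not
the equality relation. -/
structure NontrivialDefEquiv : Prop where
  homogeneous : S.Homogeneous
  definable : S.Definable E
  equivalence : Equivalence E
  exists_ne : ∃ x y, x ≠ y ∧ E x y

variable (S E) in
/-- Points at type `p` from a given point are cofinal in its `E`-class in direction `p j` of the
`j`-th order. -/
def CofinalType (p : Fin n → Bool) (j : Fin n) : Prop :=
  ∀ b z, E b z → ∃ y, S.HasType p b y ∧ E b y ∧ S.SLt j (p j) z y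

variable (S E) in
/-- Every point can be moved inside its `E`-class beyond finitely many points, in the directions
`ε`, simultaneously for all orders, whenever this is possible for each order separately. -/
def Pushing (ε : Fin n → Bool) : Prop :=
  ∀ x (A : Finset Γ), ∃ x', E x x' ∧
    ∀ a ∈ A, ∀ j, (∃ y, E x y ∧ S.SLt j (ε j) a y) → S.SLt j (ε j) a x'

theorem SLt.sign_eq {j : Fin n} {ε ε' : Bool} {x y : Γ} (h : S.SLt j ε x y)
    (h' : S.SLt j ε' x y) : ε = ε' := by
  by_contra hne
  obtain rfl : ε' = !ε := by cases ε <;> cases ε' <;> simp_all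
  exact h.asymm (sLt_not.1 h')

namespace NontrivialDefEquiv

theorem refl (h : S.NontrivialDefEquiv E) (x : Γ) : E x x := h.equivalence.refl x

theorem symm (h : S.NontrivialDefEquiv E) {x y : Γ} (hxy : E x y) : E y x := h.equivalence.symm hxy

theorem trans (h : S.NontrivialDefEquiv E)
    {x y z : Γ} (hxy : E x y) (hyz : E y z) : E x z := h.equivalence.trans hxy hyz

theorem map_iff (h : S.NontrivialDefEquiv E)
    {σ : Γ ≃ Γ} (hσ : S.IsAuto σ) {x y : Γ} : E (σ x) (σ y) ↔ E x y :=
  (h.definable σ hσ x y).symm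

theorem exists_sLt (h : S.NontrivialDefEquiv E)
    (j : Fin n) (ε : Bool) (b : Γ) : ∃ y, E b y ∧ S.SLt j ε b y := by
  obtain ⟨x, y, hne, hxy⟩ := h.exists_ne
  wlog hlt : S.SLt j ε x y generalizing x y
  · exact this y x hne.symm (h.symm hxy) ((sLt_or_sLt j ε hne).resolve_left hlt)
  obtain ⟨σ, hσ, rfl⟩ := h.homogeneous.exists_auto_map x b
  exact ⟨σ y, (h.map_iff hσ).2 hxy, hσ.sLt_iff.2 hlt⟩

theorem exists_forall_sLt (h : S.NontrivialDefEquiv E)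
    (j : Fin n) (ε : Bool) (b : Γ) (A : Finset Γ) (hA : ∀ a ∈ A, E b a) :
    ∃ y, E b y ∧ ∀ a ∈ A, S.SLt j ε a y := by
  classical
  induction A using Finset.induction_on with
  | empty => exact ⟨b, h.refl b, by simp⟩
  | insert a A _ ih =>
    obtain ⟨y, hy, hyA⟩ := ih fun x hx => hA x (Finset.mem_insert_of_mem hx)
    have ha := hA a (Finset.mem_insert_self a A)
    by_cases hay : S.SLt j ε a y
    · exact ⟨y, hy, by simpa using ⟨hay, hyA⟩⟩
    · obtain ⟨z, hz, haz⟩ := h.exists_sLt j ε a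
      refine ⟨z, h.trans ha hz, ?_⟩
      simpa using ⟨haz, fun x hx => ((hyA x hx).trans_not hay).trans haz⟩

/-- Sufficiently far out in the class of `b`, only cofinal types over `b` occur. -/
theorem exists_forall_cofinalType (h : S.NontrivialDefEquiv E) (i : Fin n) (ε : Bool) (b : Γ) :
    ∃ z, E b z ∧ S.SLt i ε b z ∧ ∀ y, E b y → S.SLt i ε z y →
      ∀ p, S.HasType p b y → p i = ε ∧ S.CofinalType E p i := by
  classical
  have key : ∀ p : Fin n → Bool, ∃ z, E b z ∧ ∀ y, E b y → S.SLt i ε z y →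
      S.HasType p b y → p i = ε ∧ S.CofinalType E p i := by
    intro p
    by_cases hp : p i = ε
    · by_cases hc : S.CofinalType E p i
      · exact ⟨b, h.refl b, fun _ _ _ _ => ⟨hp, hc⟩⟩
      · have hc' := hc
        unfold CofinalType at hc'
        push Not at hc'
        obtain ⟨b₀, z₀, hbz, hno⟩ := hc'
        obtain ⟨σ, hσ, rfl⟩ := h.homogeneous.exists_auto_map b₀ b
        refine ⟨σ z₀, (h.map_iff hσ).2 hbz, fun y hy hlt hty => ?_⟩
        obtain ⟨y, rfl⟩ := σ.surjective y
        subst hp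
        exact absurd (hσ.sLt_iff.1 hlt) (hno y (hσ.hasType_iff.1 hty) ((h.map_iff hσ).1 hy))
    · exact ⟨b, h.refl b, fun y _ hlt hty => absurd ((hty i).sign_eq hlt) hp⟩
  choose z hz hzp using key
  obtain ⟨m, hm, hmA⟩ := h.exists_forall_sLt i ε b (insert b (Finset.univ.image z)) (by
    intro a ha
    simp only [Finset.mem_insert, Finset.mem_image, Finset.mem_univ, true_and] at ha
    rcases ha with rfl | ⟨p, rfl⟩
    exacts [h.refl _, hz p])
  exact ⟨m, hm, hmA b (by simp), fun y hy hmy p hp =>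
    hzp p y hy ((hmA (z p) (by simp)).trans hmy) hp⟩

theorem exists_hasType_forall_sLt (h : S.NontrivialDefEquiv E)
    {p : Fin n → Bool} {J : Finset (Fin n)}
    (hp : ∀ j ∈ J, S.CofinalType E p j) (hne : ∃ x y, S.HasType p x y ∧ E x y) (b : Γ)
    {z : Fin n → Γ} (hz : ∀ j, E b (z j)) :
    ∃ y, S.HasType p b y ∧ E b y ∧ ∀ j ∈ J, S.SLt j (p j) (z j) y := by
  classical
  induction J using Finset.induction_on with
  | empty =>
    obtain ⟨x, y, hxy, hE⟩ := hne
    obtain ⟨σ, hσ, rfl⟩ := h.homogeneous.exists_auto_map x b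
    exact ⟨σ y, hσ.hasType_iff.2 hxy, (h.map_iff hσ).2 hE, by simp⟩
  | insert j J _ ih =>
    obtain ⟨y, hby, hE, hy⟩ := ih fun i hi => hp i (Finset.mem_insert_of_mem hi)
    obtain ⟨y', hyy', hE', hy'⟩ := hp j (Finset.mem_insert_self j J) y (z j)
      (h.trans (h.symm hE) (hz j))
    refine ⟨y', hby.trans hyy', h.trans hE hE', fun i hi => ?_⟩
    rcases Finset.mem_insert.1 hi with rfl | hi
    exacts [hy', (hy i hi).trans (hyy' i)]

theorem exists_cofinalType (h : S.NontrivialDefEquiv E)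
    (i : Fin n) (e : Bool) (b : Γ) (J : Finset (Fin n)) :
    ∃ p, p i = e ∧ (∃ x y, S.HasType p x y ∧ E x y) ∧ ∀ j ∈ insert i J, S.CofinalType E p j := by
  classical
  induction J using Finset.induction_on with
  | empty =>
    obtain ⟨z, hz, hbz, hzp⟩ := h.exists_forall_cofinalType i e b
    obtain ⟨y, hzy, hlt⟩ := h.exists_sLt i e z
    obtain ⟨p, hp⟩ := exists_hasType (S := S) (hbz.trans hlt).ne
    have := hzp y (h.trans hz hzy) hlt p hp
    exact ⟨p, this.1, ⟨b, y, hp, h.trans hz hzy⟩, by simpa using this.2⟩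
  | insert k J _ ih =>
    obtain ⟨p, hpi, hne, hp⟩ := ih
    choose z hz hbz hzp using fun j => h.exists_forall_cofinalType j (p j) b
    obtain ⟨y, hy, hky⟩ := h.exists_sLt k (p k) (z k)
    have hby := h.trans (hz k) hy
    obtain ⟨x, hyx, hEx, hx⟩ := h.exists_hasType_forall_sLt hp hne y (z := z)
      fun j => h.trans (h.symm hby) (hz j)
    have hkx := hky.trans (hyx k)
    obtain ⟨r, hr⟩ := exists_hasType (S := S) ((hbz k).trans hkx).ne
    have hE := h.trans hby hEx
    refine ⟨r, ?_, ⟨b, x, hr, hE⟩, fun j hj => ?_⟩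
    · rw [(hzp i x hE (hx i (by simp)) r hr).1, hpi]
    · rw [Finset.insert_comm] at hj
      rcases Finset.mem_insert.1 hj with rfl | hj
      exacts [(hzp _ x hE hkx r hr).2, (hzp j x hE (hx j hj) r hr).2]

theorem exists_pushing (h : S.NontrivialDefEquiv E)
    (i : Fin n) (e : Bool) : ∃ ε, ε i = e ∧ S.Pushing E ε := by
  classical
  obtain ⟨b, -, -⟩ := h.exists_ne
  obtain ⟨p, hpi, hne, hp⟩ := h.exists_cofinalType i e b Finset.univ
  refine ⟨p, hpi, fun x A => ?_⟩
  induction A using Finset.induction_on with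
  | empty => exact ⟨x, h.refl x, by simp⟩
  | insert a A _ ih =>
    obtain ⟨x', hx', hA⟩ := ih
    have hz : ∀ j, ∃ z, E x' z ∧ ((∃ y, E x y ∧ S.SLt j (p j) a y) → S.SLt j (p j) a z) := by
      intro j
      by_cases hy : ∃ y, E x y ∧ S.SLt j (p j) a y
      · obtain ⟨y, hxy, hay⟩ := hy
        exact ⟨y, h.trans (h.symm hx') hxy, fun _ => hay⟩
      · exact ⟨x', h.refl x', fun hy' => absurd hy' hy⟩
    choose z hz hza using hz
    obtain ⟨y, hty, hE, hy⟩ := h.exists_hasType_forall_sLt (J := Finset.univ)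
      (fun j _ => hp j (by simp)) hne x' hz
    refine ⟨y, h.trans hx' hE, fun c hc j hj => ?_⟩
    rcases Finset.mem_insert.1 hc with rfl | hc
    exacts [(hza j hj).trans (hy j (Finset.mem_univ j)), (hA c hc j hj).trans (hty j)]

end NontrivialDefEquiv

end Pushing

section Classes

variable {n : ℕ} {Γ : Type*} {S : PermStruct n Γ} {E : Γ → Γ → Prop}

variable (S E) in
/-- The class of `y` is cofinal over the class of `x` in direction `e` of the `j`-th order. -/
def ClassLE (j : Fin n) (e : Bool) (x y : Γ) : Prop :=
  ∀ x', E x x' → ∃ y', E y y' ∧ S.SLt j e x' y'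

variable (S E) in
/-- `x` lies beyond `a` whenever some point of its class does, and beyond the whole class of `a`
unless this class is cofinal over that of `x`. -/
def Above (ε : Fin n → Bool) (x a : Γ) : Prop :=
  ∀ j, ((∃ x', E x x' ∧ S.SLt j (ε j) a x') → S.SLt j (ε j) a x) ∧
    (¬ S.ClassLE E j (ε j) x a → ∀ a', E a a' → S.SLt j (ε j) a' x)

open Classical in
variable (S E) in
/-- The type of a pair of generic representatives of the classes of `x` and `y`. -/
noncomputable def classType (ε : Fin n → Bool) (x y : Γ) : Fin n → Bool :=
  fun j => if S.ClassLE E j (ε j) x y then ε j else !ε j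

variable (S E) in
/-- The class of `x` lies strictly inside the convex hull of the class of `y`. -/
def Nested (j : Fin n) (e : Bool) (x y : Γ) : Prop :=
  ∃ w₀ w₁, E y w₀ ∧ E y w₁ ∧ ∀ x', E x x' → S.SLt j e w₀ x' ∧ S.SLt j e x' w₁

variable (S E) in
/-- The whole class of `x` precedes the whole class of `y`. -/
def Before (j : Fin n) (e : Bool) (x y : Γ) : Prop :=
  ∀ x' y', E x x' → E y y' → S.SLt j e x' y'

theorem SLt.not_trans {j : Fin n} {ε : Bool} {x y z : Γ} (h : ¬ S.SLt j ε x y)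
    (h' : S.SLt j ε x z) : S.SLt j ε y z := by
  rcases eq_or_sLt_of_not_sLt h with rfl | h
  · exact h'
  · exact h.trans h'

theorem IsAuto.symm {σ : Γ ≃ Γ} (hσ : S.IsAuto σ) : S.IsAuto σ.symm :=
  fun j x y => by rw [hσ j (σ.symm x)]; simp

theorem ClassLE.trans {j : Fin n} {e : Bool} {x y z : Γ} (hxy : S.ClassLE E j e x y)
    (hyz : S.ClassLE E j e y z) : S.ClassLE E j e x z := by
  intro u hu
  obtain ⟨v, hv, huv⟩ := hxy u hu
  obtain ⟨w, hw, hvw⟩ := hyz v hv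
  exact ⟨w, hw, huv.trans hvw⟩

theorem Nested.trans {i : Fin n} {e : Bool} {x y z : Γ} (hxy : S.Nested E i e x y)
    (hyz : S.Nested E i e y z) : S.Nested E i e x z := by
  obtain ⟨w₀, w₁, h₀, h₁, hw⟩ := hxy
  obtain ⟨v₀, v₁, k₀, k₁, hv⟩ := hyz
  exact ⟨v₀, v₁, k₀, k₁, fun u hu =>
    ⟨(hv w₀ h₀).1.trans (hw u hu).1, (hw u hu).2.trans (hv w₁ h₁).2⟩⟩

theorem exists_not_rel_of_meet_irreducible (hproper : ¬ ∀ x y, E x y)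
    (hirr : ∀ F G : Γ → Γ → Prop, S.Definable F → Equivalence F →
      S.Definable G → Equivalence G → (∀ x y, E x y ↔ F x y ∧ G x y) →
      (∀ x y, E x y ↔ F x y) ∨ (∀ x y, E x y ↔ G x y)) {ι : Type*} {R : ι → Γ → Γ → Prop}
    (J : Finset ι) (hdef : ∀ j ∈ J, S.Definable (R j)) (heq : ∀ j ∈ J, Equivalence (R j))
    (hle : ∀ j ∈ J, ∀ x y, E x y → R j x y) (hne : ∀ j ∈ J, ∃ x y, R j x y ∧ ¬ E x y) :
    ∃ x y, ¬ E x y ∧ ∀ j ∈ J, R j x y := by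
  classical
  induction J using Finset.induction_on with
  | empty =>
    push Not at hproper
    simpa using hproper
  | insert j J _ ih =>
    simp only [Finset.forall_mem_insert] at hdef heq hle hne ⊢
    obtain ⟨x, y, hxy, hJ⟩ := ih hdef.2 heq.2 hle.2 hne.2
    obtain ⟨x', y', hR, hxy'⟩ := hne.1
    by_contra! hno
    rcases hirr (R j) (fun x y => ∀ i ∈ J, R i x y) hdef.1 heq.1
      (fun σ hσ x y => forall₂_congr fun i hi => hdef.2 i hi σ hσ x y)
      ⟨fun x i hi => (heq.2 i hi).refl x, fun hR i hi => (heq.2 i hi).symm (hR i hi),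
        fun hR hR' i hi => (heq.2 i hi).trans (hR i hi) (hR' i hi)⟩
      (fun x y => ⟨fun hE => ⟨hle.1 x y hE, fun i hi => hle.2 i hi x y hE⟩, fun hR => by
        by_contra hE
        obtain ⟨i, hi, hi'⟩ := hno x y hE hR.1
        exact hi' (hR.2 i hi)⟩) with hE | hE
    · exact hxy' ((hE x' y').2 hR)
    · exact hxy ((hE x y).2 hJ)

theorem exists_sLt_of_not_convex {i : Fin n} (e : Bool) (hE : Equivalence E)
    (hi : ¬ S.Convex i E) :
    ∃ a b c, S.SLt i e a b ∧ S.SLt i e b c ∧ E a c ∧ ¬ E a b := by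
  unfold Convex at hi
  push Not at hi
  obtain ⟨a, b, c, hab, hbc, hac, hnab⟩ := hi
  have hne : a ≠ b := by rintro rfl; exact hnab (hE.refl a)
  have hne' : b ≠ c := by rintro rfl; exact hnab hac
  cases e
  · exact ⟨c, b, a, ⟨hne'.symm, by simpa using hbc⟩, ⟨hne.symm, by simpa using hab⟩,
      hE.symm hac, fun hcb => hnab (hE.trans hac hcb)⟩
  · exact ⟨a, b, c, ⟨hne, by simpa using hab⟩, ⟨hne', by simpa using hbc⟩, hac, hnab⟩

namespace NontrivialDefEquiv

theorem map_iff_symm (h : S.NontrivialDefEquiv E)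
    {σ : Γ ≃ Γ} (hσ : S.IsAuto σ) {x y : Γ} : E (σ x) y ↔ E x (σ.symm y) := by
  simpa using h.map_iff hσ (x := x) (y := σ.symm y)

theorem classLE_congr (h : S.NontrivialDefEquiv E)
    {j : Fin n} {e : Bool} {x y x' y' : Γ} (hx : E x x') (hy : E y y')
    (hxy : S.ClassLE E j e x y) : S.ClassLE E j e x' y' := by
  intro u hu
  obtain ⟨v, hv, huv⟩ := hxy u (h.trans hx hu)
  exact ⟨v, h.trans (h.symm hy) hv, huv⟩

theorem classLE_map (h : S.NontrivialDefEquiv E)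
    {j : Fin n} {e : Bool} {σ : Γ ≃ Γ} (hσ : S.IsAuto σ) {x y : Γ}
    (hxy : S.ClassLE E j e x y) : S.ClassLE E j e (σ x) (σ y) := by
  intro u hu
  obtain ⟨v, hv, huv⟩ := hxy _ ((h.map_iff_symm hσ).1 hu)
  exact ⟨σ v, (h.map_iff hσ).2 hv, by simpa using hσ.sLt_iff.2 huv⟩

theorem classLE_map_iff (h : S.NontrivialDefEquiv E)
    {j : Fin n} {e : Bool} {σ : Γ ≃ Γ} (hσ : S.IsAuto σ) {x y : Γ} :
    S.ClassLE E j e (σ x) (σ y) ↔ S.ClassLE E j e x y := by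
  refine ⟨fun hxy => ?_, h.classLE_map hσ⟩
  simpa using h.classLE_map hσ.symm hxy

theorem classLE_of_rel (h : S.NontrivialDefEquiv E)
    {j : Fin n} {e : Bool} {x y : Γ} (hxy : E x y) : S.ClassLE E j e x y := by
  intro u hu
  obtain ⟨v, hv, huv⟩ := h.exists_sLt j e u
  exact ⟨v, h.trans (h.symm hxy) (h.trans hu hv), huv⟩

theorem exists_forall_sLt_of_not_classLE (h : S.NontrivialDefEquiv E)
    {j : Fin n} {e : Bool} {x y : Γ}
    (hxy : ¬ S.ClassLE E j e x y) : ∃ w, E x w ∧ ∀ y', E y y' → S.SLt j e y' w := by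
  unfold ClassLE at hxy
  push Not at hxy
  obtain ⟨u, hu, huy⟩ := hxy
  obtain ⟨w, hw, huw⟩ := h.exists_sLt j e u
  exact ⟨w, h.trans hu hw, fun y' hy' => SLt.not_trans (huy y' hy') huw⟩

theorem classType_congr (h : S.NontrivialDefEquiv E)
    (ε : Fin n → Bool) {x y x' y' : Γ} (hx : E x x') (hy : E y y') :
    S.classType E ε x y = S.classType E ε x' y' := by
  funext j
  have : S.ClassLE E j (ε j) x y ↔ S.ClassLE E j (ε j) x' y' :=
    ⟨h.classLE_congr hx hy, h.classLE_congr (h.symm hx) (h.symm hy)⟩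
  classical exact if_congr this rfl rfl

variable {ε : Fin n → Bool}

theorem exists_above (h : S.NontrivialDefEquiv E) (hε : S.Pushing E ε) (x : Γ) (A : Finset Γ) :
    ∃ x', E x x' ∧ ∀ a ∈ A, S.Above E ε x' a := by
  classical
  have hw : ∀ a j, ∃ w, E x w ∧
      (¬ S.ClassLE E j (ε j) x a → ∀ a', E a a' → S.SLt j (ε j) a' w) := by
    intro a j
    by_cases hle : S.ClassLE E j (ε j) x a
    · exact ⟨x, h.refl x, fun hle' => absurd hle hle'⟩
    · obtain ⟨w, hw, hwa⟩ := h.exists_forall_sLt_of_not_classLE hle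
      exact ⟨w, hw, fun _ => hwa⟩
  choose w hw hwa using hw
  obtain ⟨x', hx', hA⟩ := hε x (A ∪ A.biUnion fun a => Finset.univ.image (w a))
  refine ⟨x', hx', fun a ha j => ⟨?_, fun hle a' ha' => ?_⟩⟩
  · rintro ⟨y, hy, hay⟩
    exact hA a (Finset.mem_union_left _ ha) j ⟨y, h.trans hx' hy, hay⟩
  · obtain ⟨y, hy, hwy⟩ := h.exists_sLt j (ε j) (w a j)
    refine (hwa a j (fun hle' => hle (h.classLE_congr hx' (h.refl a) hle')) a' ha').trans
      (hA (w a j) (Finset.mem_union_right _ (Finset.mem_biUnion.2 ⟨a, ha, by simp⟩)) j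
        ⟨y, h.trans (hw a j) hy, hwy⟩)

theorem hasType_of_above (h : S.NontrivialDefEquiv E)
    {x y a : Γ} (hx : S.Above E ε x a) (ha : E a y) (hy : S.Above E ε y x) :
    S.HasType (S.classType E ε x y) x y := by
  intro j
  by_cases hle : S.ClassLE E j (ε j) x y
  · simpa only [classType, if_pos hle] using (hy j).1 (hle x (h.refl x))
  · simp only [classType, if_neg hle]
    exact sLt_not.2 ((hx j).2 (fun hle' => hle (h.classLE_congr (h.refl x) ha hle')) y ha)

/-- If the class of `x` is cofinal over that of `y` and some point of the class of `y` precedes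
the class of `x`, then the whole class of `y` does. -/
theorem before_of_exists (h : S.NontrivialDefEquiv E)
    [NeZero n] (hε : S.Pushing E ε) {i : Fin n} {x y : Γ}
    (hle : S.ClassLE E i (ε i) y x)
    (hex : ∃ y', E y y' ∧ ∀ x', E x x' → S.SLt i (ε i) y' x') : S.Before E i (ε i) y x := by
  classical
  obtain ⟨y', hy', hy'x⟩ := hex
  intro y₀ x₀ hy₀ hx₀
  by_contra hlt
  obtain ⟨y₁, hyy₁, hy₁⟩ := h.exists_above hε y {x, y₀}
  obtain ⟨x₁, hxx₁, hx₁⟩ := h.exists_above hε x {y₁}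
  have hy₁x : S.Above E ε y₁ x := hy₁ x (by simp)
  have hx₁y₁ : S.Above E ε x₁ y₁ := hx₁ y₁ (by simp)
  have h₁ := h.hasType_of_above hy₁x hxx₁ hx₁y₁
  have hy₁x₀ : ¬ S.SLt i (ε i) y₁ x₀ := by
    obtain ⟨v, hv, hlv⟩ := h.exists_sLt i (ε i) y₀
    exact fun hlt' => hlt (((hy₁ y₀ (by simp) i).1
      ⟨v, h.trans (h.symm hyy₁) (h.trans hy₀ hv), hlv⟩).trans hlt')
  obtain ⟨σ, hσ, rfl⟩ := h.homogeneous.exists_auto_map x₁ y'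
  obtain ⟨y₂, hyy₂, hy₂⟩ := h.exists_above hε y {x, σ y₁}
  obtain ⟨x₂, hxx₂, hx₂⟩ := h.exists_above hε x {y₂}
  have h₂ := h.hasType_of_above (hy₂ x (by simp)) hxx₂ (hx₂ y₂ (by simp))
  rw [h.classType_congr ε (h.trans (h.symm hyy₂) hyy₁) (h.trans (h.symm hxx₂) hxx₁)] at h₂
  have hσ₁ : S.HasType (S.classType E ε y₁ x₁) (σ y₁) (σ x₁) := hσ.hasType_iff.2 h₁
  have h₃ : S.HasType (S.classType E ε y₁ x₁) (σ y₁) y₂ := by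
    intro j
    have hj := hσ₁ j
    by_cases hc : S.ClassLE E j (ε j) y₁ x₁
    · simp only [classType, if_pos hc] at hj ⊢
      exact (hy₂ (σ y₁) (by simp) j).1 ⟨σ x₁, h.trans (h.symm hyy₂) hy', hj⟩
    · simp only [classType, if_neg hc]
      have hc' : ¬ S.ClassLE E j (ε j) y₁ x := fun hc' =>
        hc (h.classLE_congr (h.refl _) hxx₁ hc')
      have hE : E (σ x₁) y₂ := h.trans (h.symm hy') hyy₂
      have := hσ.sLt_iff.2 ((hy₁x j).2 hc' _ (h.trans hxx₁ ((h.map_iff_symm hσ).1 hE)))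
      exact sLt_not.2 (by simpa using this)
  obtain ⟨τ, hτ, hτy, hτx⟩ := h.homogeneous.exists_auto_of_hasType h₁ (h₃.trans h₂)
  have hi := hσ₁ i
  simp only [classType, if_pos (h.classLE_congr hyy₁ hxx₁ hle)] at hi
  refine hy₁x₀ (hτ.sLt_iff.1 ?_)
  rw [hτy]
  refine hi.trans (hy'x _ (h.trans hxx₂ ?_))
  rw [← hτx]
  exact (h.map_iff hτ).2 (h.trans (h.symm hxx₁) hx₀)

theorem exists_generic_triple (h : S.NontrivialDefEquiv E) (hε : S.Pushing E ε) (x y z : Γ) :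
    ∃ f : Fin 3 → Γ, E x (f 0) ∧ E y (f 1) ∧ E z (f 2) ∧
      S.HasType (S.classType E ε x y) (f 0) (f 1) ∧
      S.HasType (S.classType E ε x z) (f 0) (f 2) ∧
      S.HasType (S.classType E ε y z) (f 1) (f 2) := by
  classical
  obtain ⟨x', hx, hx'⟩ := h.exists_above hε x {y, z}
  obtain ⟨y', hy, hy'⟩ := h.exists_above hε y {z, x'}
  obtain ⟨z', hz, hz'⟩ := h.exists_above hε z {x', y'}
  rw [h.classType_congr ε hx hy, h.classType_congr ε hx hz, h.classType_congr ε hy hz]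
  exact ⟨![x', y', z'], hx, hy, hz,
    h.hasType_of_above (hx' y (by simp)) hy (hy' x' (by simp)),
    h.hasType_of_above (hx' z (by simp)) hz (hz' x' (by simp)),
    h.hasType_of_above (hy' z (by simp)) hz (hz' y' (by simp))⟩

/-- Triples of classes of the same generic type are conjugate. -/
theorem exists_auto_triple (h : S.NontrivialDefEquiv E)
    [NeZero n] (hε : S.Pushing E ε) {t : Fin n → Bool}
    {x y z a b c : Γ} (hxy : S.classType E ε x y = t) (hxz : S.classType E ε x z = t)
    (hyz : S.classType E ε y z = t) (hab : S.classType E ε a b = t)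
    (hac : S.classType E ε a c = t) (hbc : S.classType E ε b c = t) :
    ∃ σ : Γ ≃ Γ, S.IsAuto σ ∧ E (σ x) a ∧ E (σ y) b ∧ E (σ z) c := by
  obtain ⟨f, hx, hy, hz, h01, h02, h12⟩ := h.exists_generic_triple hε x y z
  obtain ⟨g, ha, hb, hc, k01, k02, k12⟩ := h.exists_generic_triple hε a b c
  obtain ⟨σ, hσ, hfg⟩ := h.homogeneous.exists_auto_of_pairwise (f := f) (g := g) (by
    intro p q hpq
    refine ⟨t, ?_⟩
    fin_cases p <;> fin_cases q <;> simp_all)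
  refine ⟨σ, hσ, ?_, ?_, ?_⟩
  · exact h.trans ((h.map_iff hσ).2 hx) (by rw [hfg]; exact h.symm ha)
  · exact h.trans ((h.map_iff hσ).2 hy) (by rw [hfg]; exact h.symm hb)
  · exact h.trans ((h.map_iff hσ).2 hz) (by rw [hfg]; exact h.symm hc)

variable {i : Fin n} {e : Bool}

theorem nested_congr (h : S.NontrivialDefEquiv E) {x y x' y' : Γ} (hx : E x x') (hy : E y y')
    (hxy : S.Nested E i e x y) : S.Nested E i e x' y' := by
  obtain ⟨w₀, w₁, h₀, h₁, hw⟩ := hxy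
  exact ⟨w₀, w₁, h.trans (h.symm hy) h₀, h.trans (h.symm hy) h₁, fun u hu => hw u (h.trans hx hu)⟩

theorem nested_map (h : S.NontrivialDefEquiv E)
    {σ : Γ ≃ Γ} (hσ : S.IsAuto σ) {x y : Γ} (hxy : S.Nested E i e x y) :
    S.Nested E i e (σ x) (σ y) := by
  obtain ⟨w₀, w₁, h₀, h₁, hw⟩ := hxy
  refine ⟨σ w₀, σ w₁, (h.map_iff hσ).2 h₀, (h.map_iff hσ).2 h₁, fun u hu => ?_⟩
  obtain ⟨u, rfl⟩ := σ.surjective u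
  simpa only [hσ.sLt_iff] using hw u ((h.map_iff hσ).1 hu)

theorem nested_map_iff (h : S.NontrivialDefEquiv E) {σ : Γ ≃ Γ} (hσ : S.IsAuto σ) {x y : Γ} :
    S.Nested E i e (σ x) (σ y) ↔ S.Nested E i e x y := by
  refine ⟨fun hxy => ?_, h.nested_map hσ⟩
  simpa using h.nested_map hσ.symm hxy

/-- Inside every class hull that contains another class there are two disjoint class hulls. -/
theorem exists_branching (h : S.NontrivialDefEquiv E) {a b : Γ} (hab : S.Nested E i e a b) (w : Γ) :
    ∃ u v, S.Nested E i e u w ∧ S.Nested E i e v w ∧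
      ∀ x, S.Nested E i e x u → ¬ S.Nested E i e x v := by
  obtain ⟨σ, hσ, rfl⟩ := h.homogeneous.exists_auto_map b w
  have hN := h.nested_map hσ hab
  obtain ⟨w₀, w₁, h₀, h₁, hw⟩ := id hN
  obtain ⟨τ, hτ, rfl⟩ := h.homogeneous.exists_auto_map w₀ w₁
  have hτb : E (τ (σ b)) (σ b) := h.trans ((h.map_iff hτ).2 h₀) (h.symm h₁)
  refine ⟨σ a, τ (σ a), hN, h.nested_congr (h.refl _) hτb (h.nested_map hτ hN), ?_⟩
  rintro x ⟨_, p, -, hp, hxp⟩ ⟨q, _, hq, -, hxq⟩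
  obtain ⟨q, rfl⟩ := τ.surjective q
  have h1 := (hxp x (h.refl x)).2.trans (hw p hp).2
  have h2 := (hτ.sLt_iff.2 (hw q ((h.map_iff hτ).1 hq)).1).trans (hxq x (h.refl x)).1
  exact h1.asymm h2

theorem nested_or_before (h : S.NontrivialDefEquiv E)
    [NeZero n] {ε' : Fin n → Bool} (hε' : S.Pushing E ε')
    (hi : ε' i = !e) {x y : Γ} (hyx : ¬ S.ClassLE E i e y x) :
    S.Nested E i e x y ∨ S.Before E i e x y := by
  obtain ⟨w₁, hw₁, hxw₁⟩ := h.exists_forall_sLt_of_not_classLE hyx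
  by_cases hle : S.ClassLE E i (!e) y x
  · refine Or.inr fun x' y' hx' hy' => ?_
    rw [← hi] at hle
    have := h.before_of_exists hε' hle ⟨w₁, hw₁, fun x' hx' => by
      rw [hi, sLt_not]; exact hxw₁ x' hx'⟩ y' x' hy' hx'
    rwa [hi, sLt_not] at this
  · obtain ⟨w₀, hw₀, hxw₀⟩ := h.exists_forall_sLt_of_not_classLE hle
    exact Or.inl ⟨w₀, w₁, hw₀, hw₁, fun x' hx' => ⟨sLt_not.1 (hxw₀ x' hx'), hxw₁ x' hx'⟩⟩

theorem exists_classLE_of_not_convex (h : S.NontrivialDefEquiv E)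
    [NeZero n] {ε' : Fin n → Bool} (hε : S.Pushing E ε)
    (hε' : S.Pushing E ε') (hi : ε' i = !ε i) (hconv : ¬ S.Convex i E) :
    ∃ x y, ¬ E x y ∧ S.ClassLE E i (ε i) x y ∧ S.ClassLE E i (ε i) y x := by
  by_contra! hno
  have tri : ∀ x y, ¬ E x y → S.Nested E i (ε i) x y ∨ S.Nested E i (ε i) y x ∨
      S.Before E i (ε i) x y ∨ S.Before E i (ε i) y x := by
    intro x y hxy
    by_cases hle : S.ClassLE E i (ε i) x y
    · have := h.nested_or_before hε' hi (hno x y hxy hle)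
      tauto
    · have := h.nested_or_before hε' hi hle
      tauto
  obtain ⟨a, b, ⟨hab⟩⟩ : ∃ a b, Nonempty (S.Nested E i (ε i) a b) := by
    obtain ⟨a, b, c, hab, hbc, hac, hne⟩ := exists_sLt_of_not_convex (ε i) h.equivalence hconv
    rcases tri a b hne with hN | hN | hB | hB
    · exact ⟨a, b, ⟨hN⟩⟩
    · exact ⟨b, a, ⟨hN⟩⟩
    · exact absurd hbc (hB c b hac (h.refl b)).asymm
    · exact absurd hab (hB b a (h.refl b) (h.refl a)).asymm
  have : Nonempty Γ := ⟨a⟩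
  obtain ⟨t, ⟨x, y, z, w, hxy, hxz, hyz, hxw, hyw, hzw⟩, x', y', z', v, hxy', hxz', hyz', hyv,
      hzv, hxv⟩ := exists_mono_triples (S.classType E ε)
    (fun _ _ _ => Nested.trans) (h.exists_branching hab)
  obtain ⟨σ, hσ, hx, hy, hz⟩ := h.exists_auto_triple hε hxy' hxz' hyz' hxy hxz hyz
  have hyv' : S.Nested E i (ε i) y (σ v) := h.nested_congr hy (h.refl _) (h.nested_map hσ hyv)
  have hzv' : S.Nested E i (ε i) z (σ v) := h.nested_congr hz (h.refl _) (h.nested_map hσ hzv)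
  have hxv' : ¬ S.Nested E i (ε i) x (σ v) := fun hN =>
    hxv ((h.nested_map_iff hσ).1 (h.nested_congr (h.symm hx) (h.refl _) hN))
  obtain ⟨p₀, p₁, hp₀, hp₁, hp⟩ := id hyw
  obtain ⟨q₀, q₁, hq₀, hq₁, hq⟩ := id hyv'
  have hyp := hp y (h.refl y)
  have hyq := hq y (h.refl y)
  rcases tri w (σ v) fun hE => hzw (h.nested_congr (h.refl z) (h.symm hE) hzv') with
    hN | hN | hB | hB
  · exact hxv' (hxw.trans hN)
  · exact hzw (hzv'.trans hN)
  · exact ((hB p₁ q₀ hp₁ hq₀).trans hyq.1).asymm hyp.2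
  · exact ((hB q₁ p₀ hq₁ hp₀).trans hyp.1).asymm hyq.2

/-- A meet-irreducible `E` is convex for some order other than a given one. -/
theorem exists_ne_convex (h : S.NontrivialDefEquiv E) [NeZero n] (hproper : ¬ ∀ x y, E x y)
    (hirr : ∀ F G : Γ → Γ → Prop, S.Definable F → Equivalence F →
      S.Definable G → Equivalence G → (∀ x y, E x y ↔ F x y ∧ G x y) →
      (∀ x y, E x y ↔ F x y) ∨ (∀ x y, E x y ↔ G x y)) (i₀ : Fin n) :
    ∃ i, i ≠ i₀ ∧ S.Convex i E := by
  classical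
  by_contra! hconv
  obtain ⟨ε, -, hε⟩ := h.exists_pushing i₀ true
  obtain ⟨a, b, hab, hR⟩ := exists_not_rel_of_meet_irreducible hproper hirr
    (R := fun i x y => S.ClassLE E i (ε i) x y ∧ S.ClassLE E i (ε i) y x)
    (Finset.univ.erase i₀)
    (fun i _ σ hσ x y => by simp only [h.classLE_map_iff hσ])
    (fun i _ => ⟨fun x => ⟨h.classLE_of_rel (h.refl x), h.classLE_of_rel (h.refl x)⟩,
      And.symm, fun hxy hyz => ⟨hxy.1.trans hyz.1, hyz.2.trans hxy.2⟩⟩)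
    (fun i _ x y hxy => ⟨h.classLE_of_rel hxy, h.classLE_of_rel (h.symm hxy)⟩)
    (fun i hi => by
      obtain ⟨ε', hi', hε'⟩ := h.exists_pushing i (!ε i)
      obtain ⟨x, y, hxy, hle⟩ :=
        h.exists_classLE_of_not_convex hε hε' hi' (hconv i (Finset.ne_of_mem_erase hi))
      exact ⟨x, y, hle, hxy⟩)
  wlog hlt : S.SLt i₀ (ε i₀) a b generalizing a b
  · refine this b a (fun hba => hab (h.symm hba)) (fun i hi => (hR i hi).symm) ?_
    refine (sLt_or_sLt i₀ (ε i₀) ?_).resolve_left hlt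
    rintro rfl
    exact hab (h.refl a)
  obtain ⟨b', hbb', hb'⟩ := hε b {a}
  obtain ⟨a', haa', ha'⟩ := hε a {a}
  have hty : S.HasType ε a b' := by
    intro j
    refine hb' a (by simp) j ?_
    by_cases hj : j = i₀
    · subst hj
      exact ⟨b, h.refl b, hlt⟩
    · exact (hR j (by simpa using hj)).1 a (h.refl a)
  have hty' : S.HasType ε a a' := fun j => ha' a (by simp) j (h.exists_sLt j (ε j) a)
  obtain ⟨σ, hσ, hσa, hσa'⟩ := h.homogeneous.exists_auto_of_hasType hty' hty
  have := (h.map_iff hσ).2 haa'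
  rw [hσa, hσa'] at this
  exact hab (h.trans this (h.symm hbb'))

end NontrivialDefEquiv

end Classes

end PermStruct

/-- In a homogeneous `n`-dimensional permutation structure with `n ≥ 2`, any meet-irreducible
element of the lattice of ∅-definable equivalence relations is convex with respect to at least
two of the orders. -/
theorem meet_irreducible_convex_for_two_orders
    {n : ℕ} {Γ : Type*} [Countable Γ] [Infinite Γ] (S : PermStruct n Γ)
    (hn : 2 ≤ n) (hhom : S.Homogeneous)
    (E : Γ → Γ → Prop) (hEdef : S.Definable E) (hEequiv : Equivalence E)
    (hEproper : ¬ ∀ x y, E x y)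
    (hEirr : ∀ F G : Γ → Γ → Prop, S.Definable F → Equivalence F →
      S.Definable G → Equivalence G → (∀ x y, E x y ↔ F x y ∧ G x y) →
      (∀ x y, E x y ↔ F x y) ∨ (∀ x y, E x y ↔ G x y)) :
    ∃ i j, i ≠ j ∧ S.Convex i E ∧ S.Convex j E := by
  have : NeZero n := ⟨by omega⟩
  by_cases hex : ∃ x y, x ≠ y ∧ E x y
  · have h : S.NontrivialDefEquiv E := ⟨hhom, hEdef, hEequiv, hex⟩
    obtain ⟨i, -, hi⟩ := h.exists_ne_convex hEproper hEirr 0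
    obtain ⟨j, hij, hj⟩ := h.exists_ne_convex hEproper hEirr i
    exact ⟨i, j, hij.symm, hi, hj⟩
  · push Not at hex
    have hconv : ∀ i, S.Convex i E := by
      intro i x y z hxy hyz hxz
      obtain rfl : x = z := by_contra fun hne => hex x z hne hxz
      obtain rfl := S.antisymm i x y hxy hyz
      exact hxz
    exact ⟨⟨0, by omega⟩, ⟨1, by omega⟩, by simp, hconv _, hconv _⟩
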